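/- arXiv:2303.13539 — 3 statements merged into one kernel-verified Lean document; each statement's English description precedes it below -/
import Mathlib

section
/- (Absorption probabilities form a probability distribution.) Let n and m be finite index types, Q an n×n real matrix and R an n×m real matrix, all of whose entries are nonnegative, such that Q^k → 0 entrywise and such that every row of the block matrix P = [[Q, R],[0, I]] sums to 1 (i.e., for every i in n, ∑_j Q(i,j) + ∑_a R(i,a) = 1). Then every row of the absorption-probability matrix (I − Q)^{-1}·R sums to 1, and all its entries are nonnegative. -/
open Filter Topology

namespace Matrix

variable {n : Type*} [Fintype n] [DecidableEq n]

theorem isUnit_det_one_sub_of_tendsto_pow_zero {Q : Matrix n n ℝ}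
    (hQ : Tendsto (fun k : ℕ => Q ^ k) atTop (𝓝 0)) : IsUnit (1 - Q).det := by
  have hdet : Tendsto (fun k : ℕ => (1 - Q ^ k).det) atTop (𝓝 1) := by
    have hcont : Continuous fun A : Matrix n n ℝ => (1 - A).det :=
      (continuous_const.sub continuous_id).matrix_det
    simpa [Function.comp_def] using (hcont.tendsto 0).comp hQ
  obtain ⟨k, hk⟩ := (hdet.eventually_ne one_ne_zero).exists
  rw [← mul_neg_geom_sum, det_mul] at hk
  exact isUnit_iff_ne_zero.mpr (left_ne_zero_of_mul hk)

theorem tendsto_geom_sum_inv_one_sub {Q : Matrix n n ℝ}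
    (hQ : Tendsto (fun k : ℕ => Q ^ k) atTop (𝓝 0)) :
    Tendsto (fun k : ℕ => ∑ i ∈ Finset.range k, Q ^ i) atTop (𝓝 (1 - Q)⁻¹) := by
  have hunit := isUnit_det_one_sub_of_tendsto_pow_zero hQ
  have hsum (k : ℕ) : ∑ i ∈ Finset.range k, Q ^ i = (1 - Q)⁻¹ * (1 - Q ^ k) := by
    rw [← mul_neg_geom_sum, nonsing_inv_mul_cancel_left _ _ hunit]
  have hcont : Continuous fun A : Matrix n n ℝ => (1 - Q)⁻¹ * (1 - A) :=
    continuous_const.matrix_mul (continuous_const.sub continuous_id)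
  simpa [hsum, Function.comp_def] using (hcont.tendsto 0).comp hQ

theorem inv_one_sub_apply_nonneg {Q : Matrix n n ℝ} (hQ₀ : ∀ i j, 0 ≤ Q i j)
    (hQ : Tendsto (fun k : ℕ => Q ^ k) atTop (𝓝 0)) (i j : n) : 0 ≤ (1 - Q)⁻¹ i j := by
  have hlim := ((continuous_id.matrix_elem i j).tendsto _).comp (tendsto_geom_sum_inv_one_sub hQ)
  refine ge_of_tendsto' hlim fun k => ?_
  simp only [Function.comp_apply, id_eq, sum_apply]
  exact Finset.sum_nonneg fun l _ => pow_apply_nonneg hQ₀ l i j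

end Matrix

/-- Absorption probabilities form a probability distribution. If `Q` and `R`
have nonnegative entries, `Q^k → 0` entrywise, and each row of `[[Q, R], [0, I]]` sums
to one (i.e. `∑_j Q i j + ∑_a R i a = 1` for all `i`), then every row of
`(I - Q)⁻¹ * R` sums to one and all its entries are nonnegative. -/
theorem absorption_matrix_is_stochastic {n m : Type*} [Fintype n] [Fintype m]
    [DecidableEq n]
    (Q : Matrix n n ℝ) (R : Matrix n m ℝ)
    (hQ0 : ∀ i j, 0 ≤ Q i j) (hR0 : ∀ i a, 0 ≤ R i a)
    (hrow : ∀ i, (∑ j, Q i j) + (∑ a, R i a) = 1)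
    (hQk : Filter.Tendsto (fun k : ℕ => Q ^ k) Filter.atTop (nhds (0 : Matrix n n ℝ))) :
    (∀ i, ∑ a, ((1 - Q)⁻¹ * R) i a = 1) ∧ (∀ i a, 0 ≤ ((1 - Q)⁻¹ * R) i a) := by
  refine ⟨fun i => ?_, fun i a => ?_⟩
  · have hR : R.mulVec 1 = (1 - Q).mulVec 1 := by
      ext i
      rw [Matrix.sub_mulVec, Matrix.one_mulVec]
      simp only [Matrix.mulVec, dotProduct, Pi.sub_apply, Pi.one_apply, mul_one]
      linarith [hrow i]
    have hB : ((1 - Q)⁻¹ * R).mulVec 1 = 1 := by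
      rw [← Matrix.mulVec_mulVec, hR, Matrix.mulVec_mulVec,
        Matrix.nonsing_inv_mul _ (Matrix.isUnit_det_one_sub_of_tendsto_pow_zero hQk),
        Matrix.one_mulVec]
    simpa only [Matrix.mulVec, dotProduct, Pi.one_apply, mul_one] using congrFun hB i
  · rw [Matrix.mul_apply]
    exact Finset.sum_nonneg fun j _ =>
      mul_nonneg (Matrix.inv_one_sub_apply_nonneg hQ0 hQk i j) (hR0 j a)
end

section
/- (First-step equations characterize absorption probabilities.) Let n and m be finite index types, Q an n×n real matrix with Q^k → 0 entrywise, and R an n×m real matrix. Then B = (I − Q)^{-1}·R is the unique n×m real matrix satisfying the first-step equation B = Q·B + R. -/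
open Filter Topology in
/-- If the powers of a square matrix `Q` tend to zero, then `1 - Q` is invertible. -/
theorem Matrix.isUnit_det_one_sub_of_tendsto_pow_zero_s9 {n K : Type*} [Fintype n] [DecidableEq n]
    [Field K] [TopologicalSpace K] [IsTopologicalRing K] [T1Space K] {Q : Matrix n n K}
    (hQ : Tendsto (fun k : ℕ => Q ^ k) atTop (𝓝 0)) : IsUnit (1 - Q).det := by
  have hdet : Tendsto (fun k : ℕ => (1 - Q ^ k).det) atTop (𝓝 1) := by
    have hcont : Continuous fun A : Matrix n n K => (1 - A).det :=
      (continuous_const.sub continuous_id).matrix_det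
    simpa [Function.comp_def] using (hcont.tendsto 0).comp hQ
  obtain ⟨k, hk⟩ := (hdet.eventually_ne one_ne_zero).exists
  rw [← mul_neg_geom_sum, Matrix.det_mul] at hk
  exact (left_ne_zero_of_mul hk).isUnit


/-- First-step equations characterize absorption probabilities. If
`Q^k → 0` entrywise, then `B = (I - Q)⁻¹ * R` is the unique matrix satisfying the
first-step equation `B = Q * B + R`. -/
theorem first_step_equation_unique_solution {n m : Type*} [Fintype n] [Fintype m]
    [DecidableEq n]
    (Q : Matrix n n ℝ) (R : Matrix n m ℝ)
    (hQ : Filter.Tendsto (fun k : ℕ => Q ^ k) Filter.atTop (nhds (0 : Matrix n n ℝ))) :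
    ((1 - Q)⁻¹ * R = Q * ((1 - Q)⁻¹ * R) + R) ∧
      (∀ B : Matrix n m ℝ, B = Q * B + R → B = (1 - Q)⁻¹ * R) := by
  have h := Matrix.isUnit_det_one_sub_of_tendsto_pow_zero_s9 hQ
  refine ⟨?_, fun B hB => ?_⟩
  · rw [← sub_eq_iff_eq_add']
    calc (1 - Q)⁻¹ * R - Q * ((1 - Q)⁻¹ * R) = (1 - Q) * ((1 - Q)⁻¹ * R) := by
          rw [Matrix.sub_mul, Matrix.one_mul]
      _ = R := Matrix.mul_nonsing_inv_cancel_left _ _ h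
  · have hR : (1 - Q) * B = R := by
      rw [Matrix.sub_mul, Matrix.one_mul, sub_eq_iff_eq_add']
      exact hB
    rw [← hR, Matrix.nonsing_inv_mul_cancel_left _ _ h]
end

section
/- (Stationarity of the limit matrix.) Let n and m be finite index types, Q an n×n real matrix with Q^k → 0 entrywise, R an n×m real matrix, P the block matrix [[Q, R],[0, I]], and P_∞ the block matrix [[0, (I − Q)^{-1}·R],[0, I]]. Then P_∞ · P = P_∞ and P · P_∞ = P_∞. -/
/-- If the powers of a real square matrix `Q` tend to zero, then `1 - Q` is invertible. -/
theorem Matrix.isUnit_det_one_sub_of_tendsto_pow {n : Type*} [Fintype n] [DecidableEq n]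
    {Q : Matrix n n ℝ}
    (hQ : Filter.Tendsto (fun k : ℕ => Q ^ k) Filter.atTop (nhds (0 : Matrix n n ℝ))) :
    IsUnit (1 - Q).det := by
  have hcont : Continuous fun A : Matrix n n ℝ => (1 - A).det :=
    (continuous_const.sub continuous_id).matrix_det
  have hdet : Filter.Tendsto (fun k : ℕ => (1 - Q ^ k).det) Filter.atTop (nhds 1) := by
    simpa [Function.comp_def] using (hcont.tendsto 0).comp hQ
  obtain ⟨k, hk⟩ := (hdet.eventually_ne one_ne_zero).exists
  rw [← mul_neg_geom_sum, Matrix.det_mul] at hk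
  exact (left_ne_zero_of_mul hk).isUnit

/-- Stationarity of the limit matrix. With `P = [[Q, R], [0, I]]` and
`P_∞ = [[0, (I - Q)⁻¹ * R], [0, I]]`, where `Q^k → 0` entrywise, one has
`P_∞ * P = P_∞` and `P * P_∞ = P_∞`. -/
theorem limit_matrix_stationary {n m : Type*} [Fintype n] [Fintype m]
    [DecidableEq n] [DecidableEq m]
    (Q : Matrix n n ℝ) (R : Matrix n m ℝ)
    (hQ : Filter.Tendsto (fun k : ℕ => Q ^ k) Filter.atTop (nhds (0 : Matrix n n ℝ))) :
    (Matrix.fromBlocks (0 : Matrix n n ℝ) ((1 - Q)⁻¹ * R)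
        (0 : Matrix m n ℝ) (1 : Matrix m m ℝ)) *
      (Matrix.fromBlocks Q R (0 : Matrix m n ℝ) (1 : Matrix m m ℝ)) =
      (Matrix.fromBlocks (0 : Matrix n n ℝ) ((1 - Q)⁻¹ * R)
        (0 : Matrix m n ℝ) (1 : Matrix m m ℝ)) ∧
    (Matrix.fromBlocks Q R (0 : Matrix m n ℝ) (1 : Matrix m m ℝ)) *
      (Matrix.fromBlocks (0 : Matrix n n ℝ) ((1 - Q)⁻¹ * R)
        (0 : Matrix m n ℝ) (1 : Matrix m m ℝ)) =
      (Matrix.fromBlocks (0 : Matrix n n ℝ) ((1 - Q)⁻¹ * R)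
        (0 : Matrix m n ℝ) (1 : Matrix m m ℝ)) := by
  have hmul : (1 - Q) * ((1 - Q)⁻¹ * R) = R :=
    Matrix.mul_nonsing_inv_cancel_left _ _ (Matrix.isUnit_det_one_sub_of_tendsto_pow hQ)
  have hfix : Q * ((1 - Q)⁻¹ * R) + R = (1 - Q)⁻¹ * R := by
    rw [Matrix.sub_mul, Matrix.one_mul] at hmul
    exact (sub_eq_iff_eq_add'.mp hmul).symm
  constructor
  · simp [Matrix.fromBlocks_multiply]
  · simp [Matrix.fromBlocks_multiply, hfix]
end
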